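/- Let k ≥ 3 be an integer and let n be a nonzero integer. Let A, B be sets of positive integers and let Q be a set of positive integers with Q ⊆ {ab : a ∈ A, b ∈ B} and Q ⊆ {x^k + n : x ∈ ℕ}. Let X be a real number with X ≥ max{4|n|^{34}, 4^{6(k−1)}|n|^{6k}} and suppose Q(X) ≥ (1/2)·X^{1/k}. Then at least one of the following holds: (1) max{A(X), B(X)} ≥ (1/40)·X^{1/k}; (2) max{A(X^{1/2}), B(X^{1/2})} ≥ (1/40)·X^{1/(2k)}; (3) max{A(X^{1/3}), B(X^{1/3})} ≥ (1/40)·X^{1/(3k)}. -/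

import Mathlib

open Pointwise

/-- The counting function `S(X) = |{x ∈ S : x ≤ X}|` of a set of positive integers. -/
noncomputable def cnt (S : Set ℕ) (X : ℝ) : ℕ := Set.ncard {x ∈ S | (x : ℝ) ≤ X}

/-- Distinct `k`-th powers are far apart. -/
lemma pow_pred_le_abs_pow_sub_pow {k w u v : ℕ} (hk : k ≠ 0) (huv : u ≠ v) (hu : w ≤ u)
    (hv : w ≤ v) : (w : ℤ) ^ (k - 1) ≤ |(u : ℤ) ^ k - (v : ℤ) ^ k| := by
  wlog h : v < u generalizing u v
  · rw [abs_sub_comm]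
    exact this huv.symm hv hu (lt_of_le_of_ne (not_lt.mp h) huv)
  obtain ⟨m, rfl⟩ := Nat.exists_eq_succ_of_ne_zero hk
  have h1 : (v : ℤ) + 1 ≤ u := by exact_mod_cast h
  have h2 : (w : ℤ) ^ m ≤ (v : ℤ) ^ m := by gcongr
  have h3 : (v : ℤ) ^ m ≤ (u : ℤ) ^ m := by gcongr
  have h4 : (v : ℤ) ^ m * (v + 1) ≤ (u : ℤ) ^ m * u := by gcongr
  simp only [Nat.succ_eq_add_one, Nat.add_sub_cancel, pow_succ]
  exact le_trans (by linarith) (le_abs_self _)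

/-- Gap principle: if all four products `aᵢ bⱼ` of two pairs of distinct positive integers are
`k`-th powers shifted by `n`, then the largest product is much larger than the smallest one. -/
lemma shifted_power_gap {k : ℕ} {n : ℤ} (hk : k ≠ 0) (hn : n ≠ 0) {a₁ a₂ b₁ b₂ : ℤ}
    (ha₁ : 0 < a₁) (hb₁ : 0 < b₁) (ha : a₁ < a₂) (hb : b₁ < b₂) {x₁ x₂ x₃ x₄ : ℕ}
    (h₁ : a₁ * b₁ = (x₁ : ℤ) ^ k + n) (h₂ : a₂ * b₂ = (x₂ : ℤ) ^ k + n)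
    (h₃ : a₁ * b₂ = (x₃ : ℤ) ^ k + n) (h₄ : a₂ * b₁ = (x₄ : ℤ) ^ k + n)
    (hlarge : 2 * |n| ≤ a₁ * b₁) :
    (a₁ * b₁) ^ (k - 1) ≤ 4 ^ (k - 1) * |n| ^ k * (a₂ * b₂) := by
  have hq₁ : 0 < a₁ * b₁ := by positivity
  have hq₂ : 0 < a₂ * b₂ := mul_pos (by linarith) (by linarith)
  have h12 : a₁ * b₁ ≤ a₂ * b₂ := by gcongr; linarith
  have h13 : a₁ * b₁ ≤ a₁ * b₂ := by gcongr
  have h14 : a₁ * b₁ ≤ a₂ * b₁ := by gcongr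
  have hna := le_abs_self n
  have hdiff : ((x₃ * x₄ : ℕ) : ℤ) ^ k - ((x₁ * x₂ : ℕ) : ℤ) ^ k
      = n * ((a₂ - a₁) * (b₂ - b₁)) := by
    push_cast
    rw [mul_pow, mul_pow, eq_sub_of_add_eq h₁.symm, eq_sub_of_add_eq h₂.symm,
      eq_sub_of_add_eq h₃.symm, eq_sub_of_add_eq h₄.symm]
    ring
  have hne : x₃ * x₄ ≠ x₁ * x₂ := by
    intro h
    rw [h, sub_self, eq_comm] at hdiff
    exact mul_ne_zero hn (mul_ne_zero (sub_pos.2 ha).ne' (sub_pos.2 hb).ne') hdiff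
  have hu : (a₁ * b₁) * (a₂ * b₂) ≤ 4 * ((x₁ * x₂ : ℕ) : ℤ) ^ k := by
    have := mul_le_mul (by linarith : a₁ * b₁ ≤ 2 * (x₁ : ℤ) ^ k)
      (by linarith : a₂ * b₂ ≤ 2 * (x₂ : ℤ) ^ k) hq₂.le (by positivity)
    push_cast
    rw [mul_pow]
    linarith
  have hv : (a₁ * b₁) * (a₂ * b₂) ≤ 4 * ((x₃ * x₄ : ℕ) : ℤ) ^ k := by
    have := mul_le_mul (by linarith : a₁ * b₂ ≤ 2 * (x₃ : ℤ) ^ k)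
      (by linarith : a₂ * b₁ ≤ 2 * (x₄ : ℤ) ^ k) (hq₁.le.trans h14) (by positivity)
    push_cast
    rw [mul_pow]
    linarith
  obtain ⟨w, hw₃, hw₁, hw⟩ : ∃ w : ℕ, w ≤ x₃ * x₄ ∧ w ≤ x₁ * x₂ ∧
      (a₁ * b₁) * (a₂ * b₂) ≤ 4 * (w : ℤ) ^ k := by
    rcases le_total (x₃ * x₄) (x₁ * x₂) with h | h
    · exact ⟨_, le_rfl, h, hv⟩
    · exact ⟨_, h, le_rfl, hu⟩
  have hgap : (w : ℤ) ^ (k - 1) ≤ |n| * (a₂ * b₂) := by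
    refine (pow_pred_le_abs_pow_sub_pow hk hne hw₃ hw₁).trans ?_
    rw [hdiff, abs_mul, abs_of_pos (mul_pos (sub_pos.2 ha) (sub_pos.2 hb))]
    gcongr <;> linarith
  have hpow : (a₂ * b₂) ^ k = (a₂ * b₂) ^ (k - 1) * (a₂ * b₂) := by
    rw [← pow_succ, Nat.sub_add_cancel (Nat.one_le_iff_ne_zero.2 hk)]
  refine le_of_mul_le_mul_right ?_ (pow_pos hq₂ (k - 1))
  calc (a₁ * b₁) ^ (k - 1) * (a₂ * b₂) ^ (k - 1)
      = ((a₁ * b₁) * (a₂ * b₂)) ^ (k - 1) := (mul_pow _ _ _).symm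
    _ ≤ (4 * (w : ℤ) ^ k) ^ (k - 1) := by gcongr
    _ = 4 ^ (k - 1) * ((w : ℤ) ^ (k - 1)) ^ k := by rw [mul_pow, pow_right_comm]
    _ ≤ 4 ^ (k - 1) * (|n| * (a₂ * b₂)) ^ k := by gcongr
    _ = 4 ^ (k - 1) * |n| ^ k * (a₂ * b₂) * (a₂ * b₂) ^ (k - 1) := by
      rw [mul_pow, hpow]; ring

/-- A bipartite graph without a four-cycle has at most `|S| + |T|²` edges. -/
lemma card_le_of_no_four_cycle {α β : Type*} [DecidableEq α] [DecidableEq β] (S : Finset α)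
    (T : Finset β) (E : Finset (α × β)) (hE : E ⊆ S ×ˢ T)
    (hfree : ∀ a₁ a₂ b₁ b₂, a₁ ≠ a₂ → b₁ ≠ b₂ → (a₁, b₁) ∈ E → (a₁, b₂) ∈ E →
      (a₂, b₁) ∈ E → (a₂, b₂) ∉ E) :
    E.card ≤ S.card + T.card ^ 2 := by
  classical
  rcases E.eq_empty_or_nonempty with rfl | ⟨⟨_, b₀⟩, _⟩
  · simp
  have hex : ∀ a, ∃ b, ∀ b', (a, b') ∈ E → (a, b) ∈ E := fun a => by
    by_cases h : ∃ b, (a, b) ∈ E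
    · exact h.imp fun b hb _ _ => hb
    · exact ⟨b₀, fun b' hb' => (h ⟨b', hb'⟩).elim⟩
  choose f hf using hex
  rw [← Finset.card_filter_add_card_filter_not (fun p : α × β => p.2 = f p.1)]
  refine add_le_add ?_ ?_
  · refine Finset.card_le_card_of_injOn Prod.fst ?_ ?_
    · intro p hp
      exact (Finset.mem_product.1 (hE (Finset.mem_filter.1 hp).1)).1
    · intro p hp q hq hpq
      have h₁ := (Finset.mem_filter.1 hp).2
      have h₂ := (Finset.mem_filter.1 hq).2
      exact Prod.ext hpq (by rw [h₁, h₂, hpq])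
  · rw [sq, ← Finset.card_product]
    refine Finset.card_le_card_of_injOn (fun p => (f p.1, p.2)) ?_ ?_
    · rintro ⟨a, b⟩ hp
      have h := (Finset.mem_filter.1 hp).1
      exact Finset.mem_product.2
        ⟨(Finset.mem_product.1 (hE (hf a b h))).2, (Finset.mem_product.1 (hE h)).2⟩
    · rintro ⟨a, b⟩ hp ⟨a', b'⟩ hq hpq
      obtain ⟨h₁, h₂⟩ := Finset.mem_filter.1 hp
      obtain ⟨h₃, -⟩ := Finset.mem_filter.1 hq
      obtain ⟨hff, rfl⟩ := Prod.mk.inj hpq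
      by_contra hne
      have hf' := hf a' b h₃
      simp only at hff h₂
      rw [← hff] at hf'
      exact hfree a a' (f a) b (fun h => hne (by rw [h])) (Ne.symm h₂) (hf a b h₁) h₁ hf' h₃

lemma finite_setOf_mem_le (S : Set ℕ) (X : ℝ) : {x ∈ S | (x : ℝ) ≤ X}.Finite :=
  (Set.finite_Iic ⌊X⌋₊).subset fun _ hx => Nat.le_floor hx.2

/-- The elements of `Q` in `(Y⁴, Y⁶]` that are products of an element of `A` and an element of `B`
not exceeding `R` are few, because the corresponding bipartite graph has no four-cycle. -/
lemma ncard_large_products_le {k : ℕ} {n : ℤ} (hk : 3 ≤ k) (hn : n ≠ 0) {A B Q : Set ℕ}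
    (hApos : ∀ a ∈ A, 0 < a) (hBpos : ∀ b ∈ B, 0 < b)
    (hQM : Q ⊆ {q : ℕ | ∃ x : ℕ, 0 < x ∧ (q : ℤ) = (x : ℤ) ^ k + n}) {Y : ℝ}
    (hY : 4 ^ (k - 1) * |(n : ℝ)| ^ k ≤ Y) (R : ℝ) :
    {q ∈ Q | Y ^ 4 < (q : ℝ) ∧ (q : ℝ) ≤ Y ^ 6 ∧
      ∃ a ∈ A, ∃ b ∈ B, (b : ℝ) ≤ R ∧ q = a * b}.ncard ≤ cnt A (Y ^ 6) + cnt B R ^ 2 := by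
  classical
  have hn1 : (1 : ℝ) ≤ |(n : ℝ)| := by exact_mod_cast Int.one_le_abs hn
  have hM : 4 * |(n : ℝ)| ≤ 4 ^ (k - 1) * |(n : ℝ)| ^ k :=
    mul_le_mul (le_self_pow₀ (by norm_num) (by omega)) (le_self_pow₀ hn1 (by omega))
      (by positivity) (by positivity)
  have hY1 : 1 ≤ Y := by linarith
  have hYn : 2 * |(n : ℝ)| ≤ Y ^ 4 := by
    have := le_self_pow₀ hY1 (by norm_num : 4 ≠ 0)
    linarith
  set S := (finite_setOf_mem_le A (Y ^ 6)).toFinset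
  set T := (finite_setOf_mem_le B R).toFinset
  have hmemS : ∀ {a}, a ∈ S ↔ a ∈ A ∧ (a : ℝ) ≤ Y ^ 6 := by simp [S]
  have hmemT : ∀ {b}, b ∈ T ↔ b ∈ B ∧ (b : ℝ) ≤ R := by simp [T]
  set E := (S ×ˢ T).filter fun p => p.1 * p.2 ∈ Q ∧ Y ^ 4 < ((p.1 * p.2 : ℕ) : ℝ) ∧
    ((p.1 * p.2 : ℕ) : ℝ) ≤ Y ^ 6
  have hmemE : ∀ {a b}, (a, b) ∈ E ↔ (a ∈ S ∧ b ∈ T) ∧ a * b ∈ Q ∧ Y ^ 4 < ((a * b : ℕ) : ℝ) ∧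
      ((a * b : ℕ) : ℝ) ≤ Y ^ 6 := by simp [E]
  have hordered : ∀ a₁ a₂ b₁ b₂, a₁ < a₂ → b₁ < b₂ → (a₁, b₁) ∈ E → (a₁, b₂) ∈ E →
      (a₂, b₁) ∈ E → (a₂, b₂) ∉ E := by
    intro a₁ a₂ b₁ b₂ ha hb h11 h12 h21 h22
    rw [hmemE] at h11 h12 h21 h22
    obtain ⟨⟨ha₁, hb₁⟩, hq11, hlow, -⟩ := h11
    obtain ⟨-, hq22, -, hup⟩ := h22
    obtain ⟨x₁, -, hx₁⟩ := hQM hq11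
    obtain ⟨x₂, -, hx₂⟩ := hQM hq22
    obtain ⟨x₃, -, hx₃⟩ := hQM h12.2.1
    obtain ⟨x₄, -, hx₄⟩ := hQM h21.2.1
    push_cast at hx₁ hx₂ hx₃ hx₄ hlow hup
    have hgap := shifted_power_gap (by omega) hn
      (by exact_mod_cast hApos _ (hmemS.1 ha₁).1) (by exact_mod_cast hBpos _ (hmemT.1 hb₁).1)
      (by exact_mod_cast ha) (by exact_mod_cast hb) hx₁ hx₂ hx₃ hx₄
      (by exact_mod_cast hYn.trans hlow.le)
    have hgap' : ((a₁ : ℝ) * b₁) ^ (k - 1) ≤ 4 ^ (k - 1) * |(n : ℝ)| ^ k * (a₂ * b₂) := by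
      exact_mod_cast hgap
    have hlt : Y * Y ^ 6 < Y * Y ^ 6 := calc
      Y * Y ^ 6 ≤ (Y ^ 4) ^ 2 := by
        rw [← pow_succ', ← pow_mul]; exact pow_le_pow_right₀ hY1 (by norm_num)
      _ < ((a₁ : ℝ) * b₁) ^ 2 := by gcongr
      _ ≤ ((a₁ : ℝ) * b₁) ^ (k - 1) :=
        pow_le_pow_right₀ ((one_le_pow₀ hY1).trans hlow.le) (by omega)
      _ ≤ _ := hgap'
      _ ≤ Y * Y ^ 6 := by gcongr
    exact lt_irrefl _ hlt
  have hfree : ∀ a₁ a₂ b₁ b₂, a₁ ≠ a₂ → b₁ ≠ b₂ → (a₁, b₁) ∈ E → (a₁, b₂) ∈ E →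
      (a₂, b₁) ∈ E → (a₂, b₂) ∉ E := by
    intro a₁ a₂ b₁ b₂ ha hb h11 h12 h21 h22
    rcases ha.lt_or_gt with ha | ha <;> rcases hb.lt_or_gt with hb | hb
    · exact hordered _ _ _ _ ha hb h11 h12 h21 h22
    · exact hordered _ _ _ _ ha hb h12 h11 h22 h21
    · exact hordered _ _ _ _ ha hb h21 h22 h11 h12
    · exact hordered _ _ _ _ ha hb h22 h21 h12 h11
  have hsub : {q ∈ Q | Y ^ 4 < (q : ℝ) ∧ (q : ℝ) ≤ Y ^ 6 ∧
      ∃ a ∈ A, ∃ b ∈ B, (b : ℝ) ≤ R ∧ q = a * b} ⊆ (E.image fun p => p.1 * p.2 : Finset ℕ) := by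
    rintro q ⟨hq, hlow, hup, a, ha, b, hb, hbR, rfl⟩
    refine Finset.mem_coe.2 (Finset.mem_image.2 ⟨(a, b), hmemE.2 ⟨⟨hmemS.2 ⟨ha, ?_⟩,
      hmemT.2 ⟨hb, hbR⟩⟩, hq, hlow, hup⟩, rfl⟩)
    refine le_trans ?_ hup
    exact_mod_cast Nat.le_mul_of_pos_right a (hBpos b hb)
  calc _ ≤ (E.image fun p => p.1 * p.2).card := by
        rw [← Set.ncard_coe_finset]; exact Set.ncard_le_ncard hsub (Finset.finite_toSet _)
    _ ≤ E.card := Finset.card_image_le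
    _ ≤ S.card + T.card ^ 2 :=
      card_le_of_no_four_cycle S T E (Finset.filter_subset _ _) hfree
    _ = _ := by
      rw [cnt, cnt, Set.ncard_eq_toFinset_card _ (finite_setOf_mem_le A (Y ^ 6)),
        Set.ncard_eq_toFinset_card _ (finite_setOf_mem_le B R)]

/-- Few shifted `k`-th powers lie below `Y⁴`. -/
lemma ncard_small_shifted_powers_le {k : ℕ} {n : ℤ} (hk : 3 ≤ k) (hn : n ≠ 0) {Q : Set ℕ}
    (hQM : Q ⊆ {q : ℕ | ∃ x : ℕ, 0 < x ∧ (q : ℤ) = (x : ℤ) ^ k + n}) {Y N : ℝ}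
    (hY : 4 ^ (k - 1) * |(n : ℝ)| ^ k ≤ Y) (hN : 0 ≤ N) (hNY : N ^ k = Y ^ 6) :
    ({q ∈ Q | (q : ℝ) ≤ Y ^ 4}.ncard : ℝ) ≤ N / 4 := by
  have hn1 : (1 : ℝ) ≤ |(n : ℝ)| := by exact_mod_cast Int.one_le_abs hn
  have h4Y : 4 ^ (k - 1) ≤ Y :=
    (le_mul_of_one_le_right (by positivity) (one_le_pow₀ hn1)).trans hY
  have hnY : |(n : ℝ)| ≤ Y :=
    ((le_self_pow₀ hn1 (by omega)).trans
      (le_mul_of_one_le_left (by positivity) (one_le_pow₀ (by norm_num)))).trans hY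
  have hY1 : 1 ≤ Y := hn1.trans hnY
  have hnY4 : |(n : ℝ)| ≤ Y ^ 4 := hnY.trans (le_self_pow₀ hY1 (by norm_num))
  have h4k : (2 : ℝ) * 4 ^ k ≤ Y ^ 2 := calc
    (2 : ℝ) * 4 ^ k ≤ 4 ^ 1 * 4 ^ k := by gcongr; norm_num
    _ = 4 ^ (1 + k) := (pow_add _ _ _).symm
    _ ≤ 4 ^ ((k - 1) * 2) := pow_le_pow_right₀ (by norm_num) (by omega)
    _ = (4 ^ (k - 1)) ^ 2 := pow_mul _ _ _
    _ ≤ Y ^ 2 := by gcongr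
  have hsub : {q ∈ Q | (q : ℝ) ≤ Y ^ 4} ⊆
      ((Finset.Icc 1 ⌊N / 4⌋₊).image fun x : ℕ => ((x : ℤ) ^ k + n).toNat : Finset ℕ) := by
    rintro q ⟨hq, hqY⟩
    obtain ⟨x, hx, hqx⟩ := hQM hq
    have hqx' : (q : ℝ) = (x : ℝ) ^ k + n := by exact_mod_cast hqx
    refine Finset.mem_coe.2 (Finset.mem_image.2
      ⟨x, Finset.mem_Icc.2 ⟨hx, Nat.le_floor ?_⟩, by rw [← hqx, Int.toNat_natCast]⟩)
    have hxk : (x : ℝ) ^ k ≤ 2 * Y ^ 4 := by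
      have := neg_abs_le (n : ℝ)
      linarith
    have hle : (4 * (x : ℝ)) ^ k ≤ N ^ k := calc
      (4 * (x : ℝ)) ^ k = 4 ^ k * (x : ℝ) ^ k := mul_pow _ _ _
      _ ≤ 4 ^ k * (2 * Y ^ 4) := by gcongr
      _ = (2 * 4 ^ k) * Y ^ 4 := by ring
      _ ≤ Y ^ 2 * Y ^ 4 := by gcongr
      _ = N ^ k := by rw [hNY]; ring
    have := le_of_pow_le_pow_left₀ (by omega) hN hle
    linarith
  have hcard : {q ∈ Q | (q : ℝ) ≤ Y ^ 4}.ncard ≤ ⌊N / 4⌋₊ := calc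
    _ ≤ ((Finset.Icc 1 ⌊N / 4⌋₊).image fun x : ℕ => ((x : ℤ) ^ k + n).toNat).card := by
      rw [← Set.ncard_coe_finset]; exact Set.ncard_le_ncard hsub (Finset.finite_toSet _)
    _ ≤ (Finset.Icc 1 ⌊N / 4⌋₊).card := Finset.card_image_le
    _ = ⌊N / 4⌋₊ := by simp
  exact (Nat.cast_le.2 hcard).trans (Nat.floor_le (by positivity))

/-- Claim 3.1: if `Q ⊆ AB`, `Q ⊆ {x^k + n : x ∈ ℕ}`,
`X ≥ max{4|n|^34, 4^{6(k-1)}|n|^{6k}}`, and `Q(X) ≥ X^{1/k}/2`, then one of the three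
listed lower bounds on the counting functions of `A` and `B` holds. -/
theorem counting_trichotomy (k : ℕ) (n : ℤ) (hk : 3 ≤ k) (hn : n ≠ 0)
    (A B Q : Set ℕ)
    (hApos : ∀ a ∈ A, 0 < a) (hBpos : ∀ b ∈ B, 0 < b) (hQpos : ∀ q ∈ Q, 0 < q)
    (hQAB : Q ⊆ A * B)
    (hQM : Q ⊆ {q : ℕ | ∃ x : ℕ, 0 < x ∧ (q : ℤ) = (x : ℤ) ^ k + n})
    (X : ℝ)
    (hX : max (4 * |(n : ℝ)| ^ 34) (4 ^ (6 * (k - 1)) * |(n : ℝ)| ^ (6 * k)) ≤ X)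
    (hQX : (1 / 2 : ℝ) * X ^ ((1 : ℝ) / k) ≤ (cnt Q X : ℝ)) :
    (1 / 40 : ℝ) * X ^ ((1 : ℝ) / k) ≤ (max (cnt A X) (cnt B X) : ℝ) ∨
    (1 / 40 : ℝ) * X ^ ((1 : ℝ) / (2 * k)) ≤
      (max (cnt A (X ^ ((1 : ℝ) / 2))) (cnt B (X ^ ((1 : ℝ) / 2))) : ℝ) ∨
    (1 / 40 : ℝ) * X ^ ((1 : ℝ) / (3 * k)) ≤
      (max (cnt A (X ^ ((1 : ℝ) / 3))) (cnt B (X ^ ((1 : ℝ) / 3))) : ℝ) := by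
  have hX0 : 0 < X := lt_of_lt_of_le (by positivity) hX
  have hk0 : (k : ℝ) ≠ 0 := by positivity
  set N : ℝ := X ^ ((1 : ℝ) / k) with hNdef
  set s : ℝ := X ^ ((1 : ℝ) / (2 * k)) with hsdef
  set R : ℝ := X ^ ((1 : ℝ) / 2) with hRdef
  set Y : ℝ := X ^ ((1 : ℝ) / 6) with hYdef
  have hN0 : 0 < N := Real.rpow_pos_of_pos hX0 _
  have hR0 : 0 < R := Real.rpow_pos_of_pos hX0 _
  have hNX : N ^ k = X := by
    rw [hNdef, ← Real.rpow_mul_natCast hX0.le, one_div_mul_cancel hk0, Real.rpow_one]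
  have hsN : s ^ 2 = N := by
    rw [hsdef, hNdef, ← Real.rpow_mul_natCast hX0.le]
    congr 1
    push_cast
    field_simp
  have hRX : R * R = X := by
    rw [hRdef, ← Real.rpow_add hX0]
    norm_num
  have hYX : Y ^ 6 = X := by
    rw [hYdef, ← Real.rpow_mul_natCast hX0.le]
    norm_num
  have hY : 4 ^ (k - 1) * |(n : ℝ)| ^ k ≤ Y := by
    refine le_of_pow_le_pow_left₀ (n := 6) (by norm_num) (Real.rpow_nonneg hX0.le _) ?_
    rw [hYX, mul_pow, ← pow_mul, ← pow_mul, mul_comm (k - 1), mul_comm k]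
    exact (le_max_right _ _).trans hX
  by_contra! hcon
  obtain ⟨h₁, h₂, -⟩ := hcon
  obtain ⟨hA₁, hB₁⟩ := max_lt_iff.1 h₁
  obtain ⟨hA₂, hB₂⟩ := max_lt_iff.1 h₂
  have hsmall := ncard_small_shifted_powers_le hk hn hQM hY hN0.le (hNX.trans hYX.symm)
  have hlargeA := ncard_large_products_le hk hn hApos hBpos hQM hY R
  have hlargeB := ncard_large_products_le hk hn hBpos hApos hQM hY R
  rw [hYX] at hlargeA hlargeB
  set Q₀ := {q ∈ Q | (q : ℝ) ≤ Y ^ 4}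
  set Q₁ := {q ∈ Q | Y ^ 4 < (q : ℝ) ∧ (q : ℝ) ≤ X ∧ ∃ a ∈ A, ∃ b ∈ B, (b : ℝ) ≤ R ∧ q = a * b}
  set Q₂ := {q ∈ Q | Y ^ 4 < (q : ℝ) ∧ (q : ℝ) ≤ X ∧ ∃ b ∈ B, ∃ a ∈ A, (a : ℝ) ≤ R ∧ q = b * a}
  have hcover : {q ∈ Q | (q : ℝ) ≤ X} ⊆ Q₀ ∪ Q₁ ∪ Q₂ := by
    rintro q ⟨hq, hqX⟩
    by_cases hq4 : (q : ℝ) ≤ Y ^ 4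
    · exact Or.inl (Or.inl ⟨hq, hq4⟩)
    rw [not_le] at hq4
    obtain ⟨a, ha, b, hb, hab⟩ := Set.mem_mul.1 (hQAB hq)
    by_cases haR : (a : ℝ) ≤ R
    · exact Or.inr ⟨hq, hq4, hqX, b, hb, a, ha, haR, by rw [← hab, mul_comm]⟩
    refine Or.inl (Or.inr ⟨hq, hq4, hqX, a, ha, b, hb, ?_, hab.symm⟩)
    by_contra! hbR
    rw [not_le] at haR
    have hlt := mul_lt_mul'' haR hbR hR0.le hR0.le
    rw [hRX, ← Nat.cast_mul, hab] at hlt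
    exact hqX.not_gt hlt
  have hfin₀ : Q₀.Finite := finite_setOf_mem_le Q _
  have hfin₁ : Q₁.Finite := (finite_setOf_mem_le Q X).subset fun q hq => ⟨hq.1, hq.2.2.1⟩
  have hfin₂ : Q₂.Finite := (finite_setOf_mem_le Q X).subset fun q hq => ⟨hq.1, hq.2.2.1⟩
  have hQ : cnt Q X ≤ Q₀.ncard + Q₁.ncard + Q₂.ncard :=
    (Set.ncard_le_ncard hcover ((hfin₀.union hfin₁).union hfin₂)).trans
      ((Set.ncard_union_le _ _).trans (Nat.add_le_add_right (Set.ncard_union_le _ _) _))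
  have hQ' : (cnt Q X : ℝ) ≤ Q₀.ncard + (cnt A X + (cnt B R : ℝ) ^ 2)
      + (cnt B X + (cnt A R : ℝ) ^ 2) := by
    exact_mod_cast hQ.trans (by gcongr)
  have hA₃ : (cnt A R : ℝ) ^ 2 ≤ (1 / 40 * s) ^ 2 := by gcongr
  have hB₃ : (cnt B R : ℝ) ^ 2 ≤ (1 / 40 * s) ^ 2 := by gcongr
  rw [mul_pow, hsN] at hA₃ hB₃
  linarith
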